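/- The point 164/(13√173) is an isolated point of the spectrum 𝕃₂, i.e., there exists ε > 0 such that the interval (164/(13√173) − ε, 164/(13√173) + ε) contains no element of 𝕃₂ other than 164/(13√173) itself. -/

import Mathlib

open Filter

/-- The tails `αₙ = [aₙ; aₙ₊₁, …]` of the continued fraction of `α`. -/
noncomputable def cfTail (α : ℝ) : ℕ → ℝ
  | 0 => α
  | n + 1 => (Int.fract (cfTail α n))⁻¹

/-- The partial quotients `aₙ` of the continued fraction of `α`. -/
noncomputable def cfDigit (α : ℝ) (n : ℕ) : ℤ := ⌊cfTail α n⌋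

/-- Value `[a; b, c, …]` of a finite continued fraction given by a list. -/
noncomputable def finCF : List ℤ → ℝ
  | [] => 0
  | a :: l => (a : ℝ) + (finCF l)⁻¹

/-- `α*ₙ = [0; aₙ, aₙ₋₁, …, a₁]`. -/
noncomputable def cfStar (α : ℝ) (n : ℕ) : ℝ :=
  (finCF (((List.range' 1 n).reverse).map (cfDigit α)))⁻¹

/-- Numerators `pₙ` of the convergents of `α`. -/
noncomputable def cfNum (α : ℝ) : ℕ → ℤ
  | 0 => cfDigit α 0
  | 1 => cfDigit α 1 * cfDigit α 0 + 1
  | n + 2 => cfDigit α (n + 2) * cfNum α (n + 1) + cfNum α n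

/-- Denominators `qₙ` of the convergents of `α`. -/
noncomputable def cfDen (α : ℝ) : ℕ → ℤ
  | 0 => 1
  | 1 => cfDigit α 1
  | n + 2 => cfDigit α (n + 2) * cfDen α (n + 1) + cfDen α n

/-- The irrationality measure function `ψ_α^[2]` for "second best" approximations. -/
noncomputable def psi2 (α : ℝ) (t : ℝ) : ℝ :=
  sInf { x : ℝ | ∃ p q : ℤ, 1 ≤ q ∧ (q : ℝ) ≤ t ∧
    (∀ n : ℕ, (p, q) ≠ (cfNum α n, cfDen α n)) ∧ x = |(q : ℝ) * α - (p : ℝ)| }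

/-- The Diophantine constant `𝔨(α) = liminf_{t → ∞} t · ψ_α^[2](t)`. -/
noncomputable def kConst (α : ℝ) : ℝ := liminf (fun t : ℝ => t * psi2 α t) atTop

/-- Two numbers are equivalent if the tails of their continued fraction expansions
coincide: `a_{n+k} = b_{m+k}` for all `k ≥ 1`, for some positive integers `m`, `n`. -/
def CFEquiv (α β : ℝ) : Prop :=
  ∃ n m : ℕ, 0 < n ∧ 0 < m ∧ ∀ k : ℕ, 0 < k → cfDigit α (n + k) = cfDigit β (m + k)

/-- The spectrum `𝕃₂` of values of `𝔨`. -/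
def L2 : Set ℝ := { l : ℝ | ∃ α : ℝ, Irrational α ∧ l = kConst α }

/-- `κ¹ₙ(α) = (1 + α*ₙ₋₁)(αₙ − 1)/(αₙ + α*ₙ₋₁)`. -/
noncomputable def kappa1 (α : ℝ) (n : ℕ) : ℝ :=
  (1 + cfStar α (n - 1)) * (cfTail α n - 1) / (cfTail α n + cfStar α (n - 1))

/-- `κ²ₙ(α) = (1 − α*ₙ)(αₙ₊₁ + 1)/(αₙ₊₁ + α*ₙ)`. -/
noncomputable def kappa2 (α : ℝ) (n : ℕ) : ℝ :=
  (1 - cfStar α n) * (cfTail α (n + 1) + 1) / (cfTail α (n + 1) + cfStar α n)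

/-- `κ⁴ₙ(α) = 4/(αₙ + α*ₙ₋₁)`. -/
noncomputable def kappa4 (α : ℝ) (n : ℕ) : ℝ :=
  4 / (cfTail α n + cfStar α (n - 1))

section Tails

variable {α : ℝ}

theorem irrational_cfTail (hα : Irrational α) (n : ℕ) : Irrational (cfTail α n) := by
  induction n with
  | zero => exact hα
  | succ n ih =>
    have h : Irrational (Int.fract (cfTail α n)) := ih.sub_intCast _
    exact h.inv

theorem fract_cfTail_pos (hα : Irrational α) (n : ℕ) : 0 < Int.fract (cfTail α n) := by
  refine lt_of_le_of_ne (Int.fract_nonneg _) fun h => ?_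
  have h' : Irrational (Int.fract (cfTail α n)) := (irrational_cfTail hα n).sub_intCast _
  exact h'.ne_zero h.symm

theorem cfTail_eq (α : ℝ) (n : ℕ) :
    cfTail α n = cfDigit α n + Int.fract (cfTail α n) :=
  (Int.floor_add_fract _).symm

theorem fract_cfTail (α : ℝ) (n : ℕ) :
    Int.fract (cfTail α n) = (cfTail α (n + 1))⁻¹ := by
  rw [cfTail, inv_inv]

theorem one_lt_cfTail (hα : Irrational α) (n : ℕ) : 1 < cfTail α (n + 1) := by
  rw [cfTail]
  exact (one_lt_inv₀ (fract_cfTail_pos hα n)).2 (Int.fract_lt_one _)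

theorem one_le_cfDigit (hα : Irrational α) (n : ℕ) : 1 ≤ cfDigit α (n + 1) := by
  rw [cfDigit, Int.le_floor]
  exact_mod_cast (one_lt_cfTail hα n).le

theorem cfTail_cfTail (α : ℝ) (m n : ℕ) : cfTail (cfTail α m) n = cfTail α (m + n) := by
  induction n with
  | zero => rfl
  | succ n ih => rw [cfTail, ih, ← Nat.add_assoc, cfTail]

theorem cfDigit_cfTail (α : ℝ) (m n : ℕ) : cfDigit (cfTail α m) n = cfDigit α (m + n) := by
  rw [cfDigit, cfTail_cfTail, cfDigit]

/-- An irrational number is determined by its partial quotients. -/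
theorem eq_of_cfDigit_eq {β : ℝ} (hα : Irrational α) (hβ : Irrational β)
    (h : ∀ n, cfDigit α n = cfDigit β n) : α = β := by
  have hstep : ∀ n, |cfTail α n - cfTail β n| * (cfTail α (n + 1) * cfTail β (n + 1)) =
      |cfTail α (n + 1) - cfTail β (n + 1)| := by
    intro n
    have ha := one_lt_cfTail hα n
    have hb := one_lt_cfTail hβ n
    have e : (cfTail α n - cfTail β n) * (cfTail α (n + 1) * cfTail β (n + 1)) =
        -(cfTail α (n + 1) - cfTail β (n + 1)) := by
      rw [cfTail_eq α n, cfTail_eq β n, h n, fract_cfTail, fract_cfTail]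
      field_simp
      ring
    rw [← abs_neg (cfTail α (n + 1) - _), ← e, abs_mul,
      abs_of_pos (mul_pos (by linarith) (by linarith) : 0 < cfTail α (n + 1) * cfTail β (n + 1))]
  have hprod : ∀ {γ : ℝ}, Irrational γ → ∀ n, 2 ≤ cfTail γ (n + 1) * cfTail γ (n + 2) := by
    intro γ hγ n
    have h1 := one_lt_cfTail hγ (n + 1)
    have h2 : (1 : ℝ) ≤ cfDigit γ (n + 1) := by exact_mod_cast one_le_cfDigit hγ n
    have h3 : cfTail γ (n + 1) * cfTail γ (n + 2) = cfDigit γ (n + 1) * cfTail γ (n + 2) + 1 := by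
      conv_lhs => rw [cfTail_eq γ (n + 1), fract_cfTail]
      have : cfTail γ (n + 1 + 1) ≠ 0 := by linarith
      field_simp
    nlinarith
  have htwo : ∀ n, 4 * |cfTail α n - cfTail β n| ≤ |cfTail α (n + 2) - cfTail β (n + 2)| := by
    intro n
    rw [← hstep (n + 1), ← hstep n]
    have h1 := hprod hα n
    have h2 := hprod hβ n
    have h3 := abs_nonneg (cfTail α n - cfTail β n)
    have h4 : 4 ≤ (cfTail α (n + 1) * cfTail α (n + 2)) * (cfTail β (n + 1) * cfTail β (n + 2)) := by
      nlinarith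
    have := mul_le_mul_of_nonneg_left h4 h3
    calc _ = |cfTail α n - cfTail β n| * 4 := by ring
      _ ≤ _ := this
      _ = _ := by ring
  have hpow : ∀ k, 4 ^ k * |α - β| ≤ |cfTail α (2 * k) - cfTail β (2 * k)| := by
    intro k
    induction k with
    | zero => simp [cfTail]
    | succ k ih =>
      have := htwo (2 * k)
      rw [pow_succ, Nat.mul_succ]
      linarith
  have hlt : ∀ n, |cfTail α n - cfTail β n| < 1 :=
    fun n => Int.abs_sub_lt_one_of_floor_eq_floor (h n)
  by_contra hne
  have hpos : 0 < |α - β| := abs_pos.2 (sub_ne_zero.2 hne)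
  obtain ⟨k, hk⟩ := pow_unbounded_of_one_lt (|α - β|⁻¹) (by norm_num : (1 : ℝ) < 4)
  have h1 := (hpow k).trans_lt (hlt (2 * k))
  have h2 := mul_lt_mul_of_pos_right hk hpos
  rw [inv_mul_cancel₀ hpos.ne'] at h2
  linarith

end Tails

section Convergents

variable {α : ℝ}

/-- The signed error `qₙ α - pₙ` of the `n`-th convergent. -/
noncomputable def cfErr (α : ℝ) (n : ℕ) : ℝ := cfDen α n * α - cfNum α n

theorem cfErr_add_two (α : ℝ) (n : ℕ) :
    cfErr α (n + 2) = cfDigit α (n + 2) * cfErr α (n + 1) + cfErr α n := by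
  simp only [cfErr, cfDen, cfNum]
  push_cast
  ring

theorem cfTail_mul_cfErr (hα : Irrational α) (n : ℕ) :
    cfTail α (n + 2) * cfErr α (n + 1) = -cfErr α n := by
  have key : ∀ n, (cfTail α (n + 1) - cfDigit α (n + 1)) * cfTail α (n + 2) = 1 := by
    intro n
    have h : cfTail α (n + 1) - cfDigit α (n + 1) = (cfTail α (n + 2))⁻¹ := by
      rw [← fract_cfTail α (n + 1), cfTail_eq α (n + 1)]; simp [cfDigit]
    rw [h, inv_mul_cancel₀ (by linarith [one_lt_cfTail hα (n + 1)])]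
  induction n with
  | zero =>
    have h0 : cfErr α 0 * cfTail α 1 = 1 := by
      have : cfErr α 0 = Int.fract (cfTail α 0) := by
        rw [cfErr, cfDen, cfNum, Int.cast_one, one_mul]; rfl
      rw [this, fract_cfTail, inv_mul_cancel₀ (by linarith [one_lt_cfTail hα 0])]
    have h1 : cfErr α 1 = cfDigit α 1 * cfErr α 0 - 1 := by
      simp only [cfErr, cfDen, cfNum]; push_cast; ring
    linear_combination cfTail α 2 * h1 + cfTail α 2 * h0 - cfErr α 0 * key 0
  | succ n ih =>
    linear_combination cfTail α (n + 3) * cfErr_add_two α n + cfTail α (n + 3) * ih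
      - cfErr α (n + 1) * key (n + 1)

theorem cfDen_mul_cfErr_sub (α : ℝ) (n : ℕ) :
    cfDen α (n + 1) * cfErr α n - cfDen α n * cfErr α (n + 1) = (-1) ^ n := by
  induction n with
  | zero => simp only [cfErr, cfDen, cfNum]; push_cast; ring
  | succ n ih =>
    rw [cfErr_add_two, cfDen, pow_succ, ← ih]
    push_cast
    ring

theorem cfNum_mul_cfDen_sub (α : ℝ) (n : ℕ) :
    cfNum α (n + 1) * cfDen α n - cfNum α n * cfDen α (n + 1) = (-1) ^ n := by
  induction n with
  | zero => simp only [cfDen, cfNum]; ring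
  | succ n ih => rw [cfNum, cfDen, pow_succ, ← ih]; ring

theorem one_le_cfDen (hα : Irrational α) (n : ℕ) : 1 ≤ cfDen α n ∧ 1 ≤ cfDen α (n + 1) := by
  induction n with
  | zero => exact ⟨le_rfl, one_le_cfDigit hα 0⟩
  | succ n ih =>
    refine ⟨ih.2, ?_⟩
    rw [cfDen]
    nlinarith [one_le_cfDigit hα (n + 1), ih.1, ih.2]

theorem cfDen_lt_succ (hα : Irrational α) (n : ℕ) : cfDen α (n + 1) < cfDen α (n + 2) := by
  rw [cfDen]
  nlinarith [one_le_cfDigit hα (n + 1), (one_le_cfDen hα n).1, (one_le_cfDen hα n).2]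

theorem monotone_cfDen (hα : Irrational α) : Monotone (cfDen α) := by
  refine monotone_nat_of_le_succ fun n => ?_
  cases n with
  | zero => exact (one_le_cfDen hα 0).2
  | succ n => exact (cfDen_lt_succ hα n).le

theorem le_cfDen (hα : Irrational α) (n : ℕ) : (n : ℤ) ≤ cfDen α n := by
  induction n with
  | zero => exact zero_le_one.trans (one_le_cfDen hα 0).1
  | succ n ih =>
    cases n with
    | zero => simpa using (one_le_cfDen hα 0).2
    | succ n =>
      have := cfDen_lt_succ hα n
      push_cast at ih ⊢
      linarith

theorem abs_cfErr_mul (hα : Irrational α) (n : ℕ) :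
    |cfErr α (n + 1)| * (cfTail α (n + 2) * cfDen α (n + 1) + cfDen α n) = 1 := by
  have h1 := cfDen_mul_cfErr_sub α n
  have h2 := cfTail_mul_cfErr hα n
  have h3 : cfErr α (n + 1) * (cfTail α (n + 2) * cfDen α (n + 1) + cfDen α n) = -(-1) ^ n := by
    linear_combination (cfDen α (n + 1) : ℝ) * h2 - h1
  have hq0 : (1 : ℝ) ≤ cfDen α n := by exact_mod_cast (one_le_cfDen hα n).1
  have hq1 : (1 : ℝ) ≤ cfDen α (n + 1) := by exact_mod_cast (one_le_cfDen hα n).2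
  have hT := one_lt_cfTail hα (n + 1)
  have hpos : 0 < cfTail α (n + 2) * cfDen α (n + 1) + cfDen α n := by positivity
  calc _ = |cfErr α (n + 1) * (cfTail α (n + 2) * cfDen α (n + 1) + cfDen α n)| := by
        rw [abs_mul, abs_of_pos hpos]
    _ = 1 := by rw [h3]; simp

theorem cfNum_cfDen_succ (α : ℝ) (n : ℕ) :
    (cfNum α (n + 1) = cfDigit α 0 * cfNum (cfTail α 1) n + cfDen (cfTail α 1) n ∧
      cfDen α (n + 1) = cfNum (cfTail α 1) n) ∧
    (cfNum α (n + 2) = cfDigit α 0 * cfNum (cfTail α 1) (n + 1) + cfDen (cfTail α 1) (n + 1) ∧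
      cfDen α (n + 2) = cfNum (cfTail α 1) (n + 1)) := by
  induction n with
  | zero =>
    simp only [cfNum, cfDen, cfDigit_cfTail, Nat.reduceAdd, and_true]
    and_intros <;> ring
  | succ n ih =>
    refine ⟨ih.2, ?_⟩
    obtain ⟨⟨h1, h2⟩, h3, h4⟩ := ih
    constructor
    · rw [cfNum, h3, h1, cfNum, cfDen, cfDigit_cfTail, Nat.add_comm 1 (n + 2)]; ring
    · rw [cfDen, h4, h2, cfNum, cfDigit_cfTail, Nat.add_comm 1 (n + 2)]

end Convergents

section Constant

variable {α : ℝ}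

/-- The pair `(p, q)` is not a convergent of `α`. -/
def NonConvergent (α : ℝ) (p q : ℤ) : Prop := ∀ n : ℕ, (p, q) ≠ (cfNum α n, cfDen α n)

theorem psi2_nonneg (α t : ℝ) : 0 ≤ psi2 α t := by
  refine Real.sInf_nonneg ?_
  rintro x ⟨p, q, -, -, -, rfl⟩
  exact abs_nonneg _

theorem psi2_le {p q : ℤ} {t : ℝ} (hq : 1 ≤ q) (hqt : (q : ℝ) ≤ t) (h : NonConvergent α p q) :
    psi2 α t ≤ |(q : ℝ) * α - p| := by
  refine csInf_le ⟨0, ?_⟩ ⟨p, q, hq, hqt, h, rfl⟩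
  rintro x ⟨p, q, -, -, -, rfl⟩
  exact abs_nonneg _

theorem nonConvergent_two_mul (α : ℝ) (n : ℕ) :
    NonConvergent α (2 * cfNum α n) (2 * cfDen α n) := by
  intro j h
  obtain ⟨h1, h2⟩ := Prod.mk.inj h
  have h3 := cfNum_mul_cfDen_sub α j
  rw [← h1, ← h2] at h3
  have h4 : Even ((-1 : ℤ) ^ j) :=
    ⟨cfNum α (j + 1) * cfDen α n - cfNum α n * cfDen α (j + 1), by rw [← h3]; ring⟩
  have h5 : Odd ((-1 : ℤ) ^ j) := Odd.pow (by decide)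
  exact (Int.not_even_iff_odd.2 h5) h4

theorem nonConvergent_intermediate (hα : Irrational α) (n : ℕ) {r : ℤ} (hr : 1 ≤ r)
    (hra : r < cfDigit α (n + 2)) :
    NonConvergent α (r * cfNum α (n + 1) + cfNum α n) (r * cfDen α (n + 1) + cfDen α n) := by
  intro j h
  have h2 := (Prod.mk.inj h).2
  obtain ⟨h3, h4⟩ := one_le_cfDen hα n
  rcases Nat.lt_or_ge (n + 1) j with hj | hj
  · have h5 := monotone_cfDen hα hj
    rw [← h2, Nat.succ_eq_add_one, cfDen] at h5
    nlinarith
  · have h5 := monotone_cfDen hα hj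
    rw [← h2] at h5
    nlinarith

theorem le_mul_abs_of_lt_kConst {a : ℝ} (h : a < kConst α) :
    ∃ Q : ℝ, ∀ p q : ℤ, 1 ≤ q → Q ≤ q → NonConvergent α p q → a ≤ q * |(q : ℝ) * α - p| := by
  have hev := eventually_lt_of_lt_liminf h
    ⟨0, by
      rw [eventually_map]
      filter_upwards [eventually_ge_atTop 0] with t ht using mul_nonneg ht (psi2_nonneg α t)⟩
  obtain ⟨Q, hQ⟩ := eventually_atTop.1 hev
  refine ⟨Q, fun p q hq hQq hn => (hQ q hQq).le.trans ?_⟩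
  have : (1 : ℝ) ≤ q := by exact_mod_cast hq
  exact mul_le_mul_of_nonneg_left (psi2_le hq le_rfl hn) (by linarith)

theorem exists_pos_le_abs_mul_sub (hα : Irrational α) (Q : ℕ) :
    ∃ δ : ℝ, 0 < δ ∧ ∀ p q : ℤ, 1 ≤ q → q < Q → δ ≤ |(q : ℝ) * α - p| := by
  induction Q with
  | zero => exact ⟨1, one_pos, fun p q h1 h2 => absurd h2 (by push_cast; omega)⟩
  | succ Q ih =>
    obtain ⟨δ, hδ, h⟩ := ih
    rcases Nat.eq_zero_or_pos Q with rfl | hQ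
    · exact ⟨1, one_pos, fun p q h1 h2 => absurd h2 (by push_cast; omega)⟩
    have hirr : Irrational ((Q : ℝ) * α) := hα.natCast_mul hQ.ne'
    have hpos : 0 < |(Q : ℝ) * α - round ((Q : ℝ) * α)| :=
      abs_pos.2 (sub_ne_zero.2 (hirr.ne_int _))
    refine ⟨min δ _, lt_min hδ hpos, fun p q h1 h2 => ?_⟩
    rcases (Int.lt_add_one_iff.1 (by exact_mod_cast h2 : q < (Q : ℤ) + 1)).lt_or_eq with h3 | rfl
    · exact (min_le_left _ _).trans (h p q h1 h3)
    · refine (min_le_right _ _).trans ?_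
      exact_mod_cast round_le ((Q : ℝ) * α) p

theorem le_kConst {a Q : ℝ} (hα : Irrational α)
    (h : ∀ p q : ℤ, 1 ≤ q → Q ≤ q → NonConvergent α p q → a ≤ q * |(q : ℝ) * α - p|) :
    a ≤ kConst α := by
  obtain ⟨M, hM⟩ := exists_nat_gt Q
  obtain ⟨δ, hδ, hsmall⟩ := exists_pos_le_abs_mul_sub hα M
  refine le_liminf_of_le ?_ ?_
  · refine IsCoboundedUnder.of_frequently_le (a := 4) ?_
    rw [frequently_atTop]
    intro T
    obtain ⟨n, hn⟩ := exists_nat_gt T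
    have hq0 : (1 : ℝ) ≤ cfDen α n := by exact_mod_cast (one_le_cfDen hα n).1
    have hq1 : (1 : ℝ) ≤ cfDen α (n + 1) := by exact_mod_cast (one_le_cfDen hα n).2
    have hle : (n : ℝ) + 1 ≤ cfDen α (n + 1) := by exact_mod_cast le_cfDen hα (n + 1)
    have hT := one_lt_cfTail hα (n + 1)
    refine ⟨((2 * cfDen α (n + 1) : ℤ) : ℝ), by push_cast; linarith, ?_⟩
    have hp := psi2_le (by linarith [(one_le_cfDen hα n).2]) le_rfl
      (nonConvergent_two_mul α (n + 1))
    have he : |((2 * cfDen α (n + 1) : ℤ) : ℝ) * α - ((2 * cfNum α (n + 1) : ℤ) : ℝ)| =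
        2 * |cfErr α (n + 1)| := by
      rw [← abs_of_pos (two_pos : (0 : ℝ) < 2), ← abs_mul, cfErr]
      push_cast
      ring_nf
    rw [he] at hp
    have hm := abs_cfErr_mul hα n
    have h0 := abs_nonneg (cfErr α (n + 1))
    have h1 : cfDen α (n + 1) * |cfErr α (n + 1)| ≤ 1 := by
      rw [← hm, mul_comm]
      refine mul_le_mul_of_nonneg_left ?_ h0
      nlinarith
    push_cast
    push_cast at hp
    nlinarith
  · filter_upwards [eventually_ge_atTop (max 1 (a / δ))] with t ht
    have ht1 := (le_max_left _ _).trans ht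
    have ht2 := (div_le_iff₀ hδ).1 ((le_max_right _ _).trans ht)
    rw [mul_comm, ← div_le_iff₀ (by linarith)]
    refine le_csInf ?_ ?_
    · obtain ⟨p, hp⟩ : ∃ p : ℤ, NonConvergent α p 1 := by
        refine ⟨max (cfNum α 0) (cfNum α 1) + 1, fun n hn => ?_⟩
        obtain ⟨h1, h2⟩ := Prod.mk.inj hn
        match n with
        | 0 => have := le_max_left (cfNum α 0) (cfNum α 1); omega
        | 1 => have := le_max_right (cfNum α 0) (cfNum α 1); omega
        | n + 2 => have := le_cfDen hα (n + 2); push_cast at this; omega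
      exact ⟨_, p, 1, le_rfl, by simpa using ht1, hp, rfl⟩
    · rintro x ⟨p, q, hq, hqt, hn, rfl⟩
      rw [div_le_iff₀ (by linarith), mul_comm]
      have h0 := abs_nonneg ((q : ℝ) * α - p)
      rcases lt_or_ge q (M : ℤ) with hqM | hqM
      · have := hsmall p q hq hqM
        nlinarith
      · have hqM' : (M : ℝ) ≤ q := by exact_mod_cast hqM
        have := h p q hq (by linarith) hn
        nlinarith

end Constant

section Invariance

variable {α : ℝ}

theorem kConst_le_kConst_cfTail_one (hα : Irrational α) : kConst α ≤ kConst (cfTail α 1) := by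
  set γ := cfTail α 1 with hγ
  have hγ1 : 1 < γ := one_lt_cfTail hα 0
  have hγirr : Irrational γ := irrational_cfTail hα 1
  have hαγ : (α - cfDigit α 0) * γ = 1 := by
    have h : α - cfDigit α 0 = γ⁻¹ := by
      rw [hγ, ← fract_cfTail α 0]; rfl
    rw [h, inv_mul_cancel₀ (by linarith)]
  refine le_of_forall_lt fun a ha => ?_
  obtain ⟨b, hab, hb⟩ := exists_between ha
  obtain ⟨c, hbc, hc⟩ := exists_between hb
  obtain ⟨Q, hQ⟩ := le_mul_abs_of_lt_kConst hc
  refine hab.trans_le (le_kConst (Q := max (max Q 2) (max b (b / (c - b)))) hγirr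
    fun p q hq hqQ hn => ?_)
  obtain ⟨⟨hQ1, hQ2⟩, hQ3, hQ4⟩ : (Q ≤ q ∧ (2 : ℝ) ≤ q) ∧ b ≤ q ∧ b / (c - b) ≤ q := by
    simpa only [max_le_iff] using hqQ
  rw [div_le_iff₀ (by linarith)] at hQ4
  by_contra! hlt
  set e := (q : ℝ) * γ - p with he
  have he0 := abs_nonneg e
  have he1 : |e| ≤ 1 := by nlinarith
  have he2 : |e| < c - b := by nlinarith
  have hp : (q : ℝ) ≤ p := by
    have h1 := le_abs_self e
    have h2 : (q : ℝ) < p + 1 := by nlinarith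
    exact_mod_cast Int.lt_add_one_iff.1 (by exact_mod_cast h2 : q < p + 1)
  have hpq : (1 : ℤ) < p := by
    have : (1 : ℝ) < p := by linarith
    exact_mod_cast this
  have hn' : NonConvergent α (cfDigit α 0 * p + q) p := by
    intro j hj
    obtain ⟨h1, h2⟩ := Prod.mk.inj hj
    cases j with
    | zero => rw [cfDen] at h2; omega
    | succ j =>
      obtain ⟨h3, h4⟩ := (cfNum_cfDen_succ α j).1
      refine hn j (Prod.ext (h2.trans h4) ?_)
      rw [h3, h2, h4] at h1
      simpa using h1
  have hval := hQ _ p hpq.le (hQ1.trans hp) hn'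
  have hE : (p : ℝ) * α - ((cfDigit α 0 * p + q : ℤ) : ℝ) = -(α - cfDigit α 0) * e := by
    push_cast
    linear_combination (q : ℝ) * hαγ
  have hδ : 0 < α - cfDigit α 0 := by
    by_contra! h
    nlinarith
  rw [hE, abs_mul, abs_neg, abs_of_pos hδ] at hval
  have hpe : (p : ℝ) * ((α - cfDigit α 0) * |e|) = q * |e| - (α - cfDigit α 0) * (e * |e|) := by
    linear_combination (q : ℝ) * |e| * hαγ - |e| * (α - cfDigit α 0) * he
  have h1 : (α - cfDigit α 0) * -(e * |e|) ≤ |e| := by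
    have h2 : -(e * |e|) ≤ |e| := by nlinarith [neg_abs_le e]
    have h3 : α - cfDigit α 0 ≤ 1 := by nlinarith
    rcases le_or_gt (-(e * |e|)) 0 with h | h <;> nlinarith
  linarith

theorem kConst_cfTail_one_le_kConst (hα : Irrational α) : kConst (cfTail α 1) ≤ kConst α := by
  set γ := cfTail α 1 with hγ
  have hγ1 : 1 < γ := one_lt_cfTail hα 0
  have hαγ : (α - cfDigit α 0) * γ = 1 := by
    have h : α - cfDigit α 0 = γ⁻¹ := by
      rw [hγ, ← fract_cfTail α 0]; rfl
    rw [h, inv_mul_cancel₀ (by linarith)]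
  refine le_of_forall_lt fun a ha => ?_
  obtain ⟨b, hab, hb⟩ := exists_between ha
  obtain ⟨c, hbc, hc⟩ := exists_between hb
  obtain ⟨Q, hQ⟩ := le_mul_abs_of_lt_kConst hc
  refine hab.trans_le (le_kConst (Q := max (γ * (max Q 1 + 1)) (max b (b * γ / (c - b)))) hα
    fun p q hq hqQ hn => ?_)
  obtain ⟨hQ1, hQ3, hQ4⟩ : γ * (max Q 1 + 1) ≤ q ∧ b ≤ q ∧ b * γ / (c - b) ≤ q := by
    simpa only [max_le_iff] using hqQ
  rw [div_le_iff₀ (by linarith)] at hQ4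
  by_contra! hlt
  set e := (q : ℝ) * α - p with he
  have hq' : (1 : ℝ) ≤ q := by exact_mod_cast hq
  have he0 := abs_nonneg e
  have he1 : |e| ≤ 1 := by nlinarith
  have he2 : γ * |e| < c - b := by nlinarith
  have hs : ((p - cfDigit α 0 * q : ℤ) : ℝ) = q * (α - cfDigit α 0) - e := by
    push_cast
    linear_combination -he
  have hs' : max Q 1 ≤ ((p - cfDigit α 0 * q : ℤ) : ℝ) := by
    rw [hs]
    have h2 := le_abs_self e
    have h3 : max Q 1 + 1 ≤ q * (α - cfDigit α 0) := by
      refine le_of_mul_le_mul_left ?_ (by linarith : 0 < γ)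
      calc γ * (max Q 1 + 1) ≤ q := hQ1
        _ = γ * (q * (α - cfDigit α 0)) := by linear_combination -(q : ℝ) * hαγ
    linarith
  have hn' : NonConvergent γ q (p - cfDigit α 0 * q) := by
    intro j hj
    obtain ⟨h1, h2⟩ := Prod.mk.inj hj
    obtain ⟨h3, h4⟩ := (cfNum_cfDen_succ α j).1
    refine hn (j + 1) (Prod.ext ?_ (h1.trans h4.symm))
    rw [h3, ← h1, ← h2]
    ring
  have hval := hQ _ _ (by exact_mod_cast (le_max_right Q 1).trans hs')
    ((le_max_left Q 1).trans hs') hn'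
  have hE : ((p - cfDigit α 0 * q : ℤ) : ℝ) * γ - q = -γ * e := by
    rw [hs]
    linear_combination (q : ℝ) * hαγ
  rw [hE, abs_mul, abs_neg, abs_of_pos (by linarith : 0 < γ), hs] at hval
  have hpe : (q * (α - cfDigit α 0) - e) * (γ * |e|) = q * |e| - γ * (e * |e|) := by
    linear_combination (q : ℝ) * |e| * hαγ
  have h1 : γ * -(e * |e|) ≤ γ * |e| := by
    refine mul_le_mul_of_nonneg_left ?_ (by linarith)
    nlinarith [neg_abs_le e]
  linarith

theorem kConst_cfTail (hα : Irrational α) (n : ℕ) : kConst (cfTail α n) = kConst α := by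
  induction n with
  | zero => rfl
  | succ n ih =>
    have h := irrational_cfTail hα n
    rw [← ih, ← cfTail_cfTail α n 1]
    exact le_antisymm (kConst_cfTail_one_le_kConst h) (kConst_le_kConst_cfTail_one h)

/-- The constant `𝔨` takes a single value on the numbers whose partial quotients are eventually a
given sequence. -/
theorem kConst_eq_of_cfDigit_eq {β : ℝ} (hα : Irrational α) (hβ : Irrational β) {m n : ℕ}
    (h : ∀ k, cfDigit α (m + k) = cfDigit β (n + k)) : kConst α = kConst β := by
  rw [← kConst_cfTail hα m, ← kConst_cfTail hβ n]
  congr 1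
  refine eq_of_cfDigit_eq (irrational_cfTail hα m) (irrational_cfTail hβ n) fun k => ?_
  rw [cfDigit_cfTail, cfDigit_cfTail, h]

end Invariance

section Combinatorics

/-- Partial quotients `a` with forward tails `X` and backward tails `Y` such that, at each place,
the three smallest candidate values for `𝔨` are at least `0.9591`. -/
structure Admissible (a : ℕ → ℤ) (X Y : ℕ → ℝ) : Prop where
  one_le : ∀ n, 1 ≤ a n
  X_pos : ∀ n, 0 < X n
  X_lt : ∀ n, X n < 1
  Y_pos : ∀ n, 0 < Y n
  Y_le : ∀ n, Y n ≤ 1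
  X_rec : ∀ n, X n * (a (n + 1) + X (n + 1)) = 1
  Y_rec : ∀ n, Y (n + 1) * (a n + Y n) = 1
  double : ∀ n, 9591 / 10000 * (a n + X n + Y n) ≤ 4
  first : ∀ n, 2 ≤ a n → 9591 / 10000 * (a n + X n + Y n) ≤ (1 + Y n) * (a n - 1 + X n)
  last : ∀ n, 2 ≤ a n → 9591 / 10000 * (a n + X n + Y n) ≤ (a n - 1 + Y n) * (1 + X n)

/-- An admissible sequence whose partial quotients are `1` or `3`. -/
structure Reduced (a : ℕ → ℤ) (X Y : ℕ → ℝ) : Prop where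
  digit : ∀ n, a n = 1 ∨ a n = 3
  le_X : ∀ n, 1 / 4 ≤ X n
  X_le : ∀ n, X n ≤ 4 / 5
  le_Y : ∀ n, 1 / 4 ≤ Y n
  Y_le : ∀ n, Y n ≤ 4 / 5
  X_rec : ∀ n, X n * (a (n + 1) + X (n + 1)) = 1
  Y_rec : ∀ n, Y (n + 1) * (a n + Y n) = 1
  double : ∀ n, a n = 3 → 9591 / 10000 * (3 + X n + Y n) ≤ 4
  first : ∀ n, a n = 3 → 9591 / 10000 * (3 + X n + Y n) ≤ (1 + Y n) * (2 + X n)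
  last : ∀ n, a n = 3 → 9591 / 10000 * (3 + X n + Y n) ≤ (2 + Y n) * (1 + X n)

theorem le_of_mul_add_eq_one {x y d l c : ℝ} (h : x * (d + y) = 1) (hl : l ≤ y) (hd : 0 < d + l)
    (hc : 1 ≤ c * (d + l)) : x ≤ c := by
  have hx : 0 < x := pos_of_mul_pos_left (by linarith) (by linarith : 0 ≤ d + y)
  by_contra! hlt
  nlinarith

theorem ge_of_mul_add_eq_one {x y d u c : ℝ} (h : x * (d + y) = 1) (hu : y ≤ u) (hd : 0 < d + y)
    (hc : c * (d + u) ≤ 1) : c ≤ x := by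
  have hx : 0 < x := pos_of_mul_pos_left (by linarith) hd.le
  by_contra! hlt
  nlinarith

namespace Admissible

variable {a : ℕ → ℤ} {X Y : ℕ → ℝ}

theorem le_three (h : Admissible a X Y) (n : ℕ) : a n ≤ 3 := by
  have four : ∀ n, a n ≤ 4 := by
    intro n
    have h1 := h.double n
    have h2 := h.X_pos n
    have h3 := h.Y_pos n
    have : (a n : ℝ) < 5 := by linarith
    exact Int.lt_add_one_iff.1 (by exact_mod_cast this)
  by_contra! hlt
  have h4 : a n = 4 := le_antisymm (four n) hlt
  have h1 := h.double n
  have h3 := h.Y_pos n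
  have h5 : ((a (n + 1) : ℤ) : ℝ) ≤ 4 := by exact_mod_cast four (n + 1)
  have h6 := h.X_rec n
  have h7 := h.X_pos n
  have h8 := h.X_lt (n + 1)
  rw [h4] at h1
  push_cast at h1
  nlinarith

theorem quarter_le_X (h : Admissible a X Y) (n : ℕ) : 1 / 4 ≤ X n := by
  have h1 : (a (n + 1) : ℝ) ≤ 3 := by exact_mod_cast h.le_three (n + 1)
  have h2 := h.X_lt (n + 1)
  have h3 := h.X_rec n
  have h4 := h.X_pos n
  nlinarith

theorem quarter_le_Y (h : Admissible a X Y) (n : ℕ) : 1 / 4 ≤ Y (n + 1) := by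
  have h1 : (a n : ℝ) ≤ 3 := by exact_mod_cast h.le_three n
  have h2 := h.Y_le n
  have h3 := h.Y_rec n
  have h4 := h.Y_pos (n + 1)
  nlinarith

theorem X_le_four_fifths (h : Admissible a X Y) (n : ℕ) : X n ≤ 4 / 5 := by
  have h1 : (1 : ℝ) ≤ a (n + 1) := by exact_mod_cast h.one_le (n + 1)
  have h2 := h.quarter_le_X (n + 1)
  exact le_of_mul_add_eq_one (h.X_rec n) h2 (by linarith) (by linarith)

theorem Y_le_four_fifths (h : Admissible a X Y) (n : ℕ) : Y (n + 2) ≤ 4 / 5 := by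
  have h1 : (1 : ℝ) ≤ a (n + 1) := by exact_mod_cast h.one_le (n + 1)
  have h2 := h.quarter_le_Y n
  exact le_of_mul_add_eq_one (h.Y_rec (n + 1)) h2 (by linarith) (by linarith)

theorem reduced (h : Admissible a X Y) :
    Reduced (fun n => a (n + 2)) (fun n => X (n + 2)) (fun n => Y (n + 2)) where
  digit n := by
    have h1 := h.one_le (n + 2)
    have h2 := h.le_three (n + 2)
    have h3 : a (n + 2) ≠ 2 := by
      intro h2
      have h3 := h.first (n + 2) (by omega)
      have h4 := h.X_le_four_fifths (n + 2)
      have h5 := h.Y_le_four_fifths n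
      have h6 := h.X_pos (n + 2)
      have h7 := h.Y_pos (n + 2)
      rw [h2] at h3
      push_cast at h3
      nlinarith
    change a (n + 2) = 1 ∨ a (n + 2) = 3
    omega
  le_X n := h.quarter_le_X _
  X_le n := h.X_le_four_fifths _
  le_Y n := h.quarter_le_Y _
  Y_le n := h.Y_le_four_fifths _
  X_rec n := h.X_rec (n + 2)
  Y_rec n := h.Y_rec (n + 2)
  double n hn := by
    have := h.double (n + 2)
    rw [hn] at this
    exact_mod_cast this
  first n hn := by
    have := h.first (n + 2) (by omega)
    rw [hn] at this
    push_cast at this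
    linarith
  last n hn := by
    have := h.last (n + 2) (by omega)
    rw [hn] at this
    push_cast at this
    linarith

end Admissible

namespace Reduced

variable {a : ℕ → ℤ} {X Y : ℕ → ℝ}

theorem X_le_of (h : Reduced a X Y) {n : ℕ} {d : ℤ} {l : ℝ} (c : ℝ) (hd : a (n + 1) = d)
    (hl : l ≤ X (n + 1)) (hdl : 0 < d + l) (hc : 1 ≤ c * (d + l)) : X n ≤ c :=
  le_of_mul_add_eq_one (hd ▸ h.X_rec n) hl hdl hc

theorem le_X_of (h : Reduced a X Y) {n : ℕ} {d : ℤ} {u : ℝ} (c : ℝ) (hd : a (n + 1) = d)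
    (hu : X (n + 1) ≤ u) (hc : c * (d + u) ≤ 1) : c ≤ X n := by
  refine ge_of_mul_add_eq_one (hd ▸ h.X_rec n) hu ?_ hc
  have h1 := h.le_X (n + 1)
  have h2 : (1 : ℝ) ≤ d := by
    rcases h.digit (n + 1) with h3 | h3 <;> rw [hd] at h3 <;> rw [h3] <;> norm_num
  linarith

theorem Y_le_of (h : Reduced a X Y) {n : ℕ} {d : ℤ} {l : ℝ} (c : ℝ) (hd : a n = d)
    (hl : l ≤ Y n) (hdl : 0 < d + l) (hc : 1 ≤ c * (d + l)) : Y (n + 1) ≤ c :=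
  le_of_mul_add_eq_one (hd ▸ h.Y_rec n) hl hdl hc

theorem le_Y_of (h : Reduced a X Y) {n : ℕ} {d : ℤ} {u : ℝ} (c : ℝ) (hd : a n = d)
    (hu : Y n ≤ u) (hc : c * (d + u) ≤ 1) : c ≤ Y (n + 1) := by
  refine ge_of_mul_add_eq_one (hd ▸ h.Y_rec n) hu ?_ hc
  have h1 := h.le_Y n
  have h2 : (1 : ℝ) ≤ d := by
    rcases h.digit n with h3 | h3 <;> rw [hd] at h3 <;> rw [h3] <;> norm_num
  linarith

theorem next_eq_one (h : Reduced a X Y) {n : ℕ} (hn : a n = 3) : a (n + 1) = 1 := by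
  refine (h.digit (n + 1)).resolve_right fun h1 => ?_
  have h2 := h.X_le_of (4 / 13) h1 (h.le_X (n + 1)) (by norm_num) (by norm_num)
  have h3 := h.last n hn
  have h4 := h.Y_le n
  have h5 := h.le_Y n
  nlinarith

theorem prev_eq_one (h : Reduced a X Y) {n : ℕ} (hn : a (n + 1) = 3) : a n = 1 := by
  refine (h.digit n).resolve_right fun h1 => ?_
  have h2 := h.Y_le_of (4 / 13) h1 (h.le_Y n) (by norm_num) (by norm_num)
  have h3 := h.first (n + 1) hn
  have h4 := h.X_le (n + 1)
  have h5 := h.le_X (n + 1)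
  nlinarith

theorem next_next_eq_one (h : Reduced a X Y) {n : ℕ} (hn : a n = 3) : a (n + 2) = 1 := by
  refine (h.digit (n + 2)).resolve_right fun h1 => ?_
  have h2 := h.X_le_of (n := n + 1) (4 / 13) h1 (h.le_X _) (by norm_num) (by norm_num)
  have h3 := h.le_X_of (13 / 17) (h.next_eq_one hn) h2 (by norm_num)
  have h4 := h.first n hn
  have h5 := h.double n hn
  have h6 := h.X_le n
  have h7 := h.le_Y n
  nlinarith

theorem prev_prev_eq_one (h : Reduced a X Y) {n : ℕ} (hn : a (n + 2) = 3) : a n = 1 := by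
  refine (h.digit n).resolve_right fun h1 => ?_
  have h2 := h.Y_le_of (4 / 13) h1 (h.le_Y n) (by norm_num) (by norm_num)
  have h3 := h.le_Y_of (13 / 17) (h.prev_eq_one hn) h2 (by norm_num)
  have h4 := h.last (n + 2) hn
  have h5 := h.double (n + 2) hn
  have h6 := h.Y_le (n + 2)
  have h7 := h.le_X (n + 2)
  nlinarith

theorem Y_bounds (h : Reduced a X Y) {n : ℕ} (hn : a (n + 3) = 3) :
    558 / 1000 ≤ Y (n + 3) ∧ Y (n + 3) ≤ 643 / 1000 := by
  have h2 := h.prev_eq_one hn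
  have h1 := h.prev_prev_eq_one hn
  have hl : 5 / 19 ≤ Y (n + 1) := by
    rcases h.digit n with h0 | h0
    · exact h.le_Y_of _ h0 (h.Y_le n) (by norm_num)
    · exact h.le_Y_of _ h0 (h.Y_le n) (by norm_num)
  have hl2 := h.Y_le_of (19 / 24) h1 hl (by norm_num) (by norm_num)
  have hu2 := h.le_Y_of (5 / 9) h1 (h.Y_le (n + 1)) (by norm_num)
  exact ⟨h.le_Y_of _ h2 hl2 (by norm_num), h.Y_le_of _ h2 hu2 (by norm_num) (by norm_num)⟩

theorem run_eq_two_or_four (h : Reduced a X Y) {n : ℕ} (hn : a (n + 3) = 3) :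
    a (n + 6) = 3 ∨ a (n + 6) = 1 ∧ a (n + 7) = 1 ∧ a (n + 8) = 3 := by
  refine (h.digit (n + 6)).symm.imp_right fun h6 => ?_
  have h4 := h.next_eq_one hn
  have h5 := h.next_next_eq_one hn
  have hY := (h.Y_bounds hn).1
  have hd := h.double _ hn
  have h7 : a (n + 7) = 1 := by
    refine (h.digit (n + 7)).resolve_right fun h7 => ?_
    have x6 := h.X_le_of (n := n + 6) (4 / 13) h7 (h.le_X _) (by norm_num) (by norm_num)
    have x5 := h.le_X_of (n := n + 5) (13 / 17) h6 x6 (by norm_num)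
    have x4 := h.X_le_of (n := n + 4) (17 / 30) h5 x5 (by norm_num) (by norm_num)
    have x3 := h.le_X_of (n := n + 3) (30 / 47) h4 x4 (by norm_num)
    linarith
  refine ⟨h6, h7, (h.digit (n + 8)).resolve_left fun h8 => ?_⟩
  have x7 := h.le_X_of (n := n + 7) (5 / 9) h8 (h.X_le _) (by norm_num)
  have x6 := h.X_le_of (n := n + 6) (9 / 14) h7 x7 (by norm_num) (by norm_num)
  have x5 := h.le_X_of (n := n + 5) (14 / 23) h6 x6 (by norm_num)
  have x4 := h.X_le_of (n := n + 4) (23 / 37) h5 x5 (by norm_num) (by norm_num)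
  have x3 := h.le_X_of (n := n + 3) (37 / 60) h4 x4 (by norm_num)
  linarith

/-- A run of exactly four `1`s between two `3`s, the first of which is at place `n`. -/
def FourRun (a : ℕ → ℤ) (n : ℕ) : Prop :=
  a n = 3 ∧ a (n + 1) = 1 ∧ a (n + 2) = 1 ∧ a (n + 3) = 1 ∧ a (n + 4) = 1 ∧ a (n + 5) = 3

theorem fourRun_or (h : Reduced a X Y) {n : ℕ} (hn : a (n + 3) = 3) :
    a (n + 6) = 3 ∨ FourRun a (n + 3) :=
  (h.run_eq_two_or_four hn).imp_right fun h' =>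
    ⟨hn, h.next_eq_one hn, h.next_next_eq_one hn, h'.1, h'.2.1, h'.2.2⟩

theorem fourRun_add_eight (h : Reduced a X Y) {n : ℕ} (hn : FourRun a (n + 3)) :
    a (n + 9) = 1 ∧ a (n + 10) = 1 ∧ FourRun a (n + 11) := by
  obtain ⟨h3, h4, h5, h6, h7, h8⟩ := hn
  have h9 := h.next_eq_one h8
  have h10 := h.next_next_eq_one h8
  have hd := h.double _ h8
  have y3 := (h.Y_bounds h3).2
  have y4 := h.le_Y_of (1000 / 3643) h3 y3 (by norm_num)
  have y5 := h.Y_le_of (3643 / 4643) h4 y4 (by norm_num) (by norm_num)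
  have y6 := h.le_Y_of (4643 / 8286) h5 y5 (by norm_num)
  have y7 := h.Y_le_of (8286 / 12929) h6 y6 (by norm_num) (by norm_num)
  have y8 := h.le_Y_of (12929 / 21215) h7 y7 (by norm_num)
  have h11 : a (n + 11) = 3 := by
    refine (h.digit (n + 11)).resolve_left fun h11 => ?_
    have x10 := h.le_X_of (n := n + 10) (5 / 9) h11 (h.X_le _) (by norm_num)
    have x9 := h.X_le_of (n := n + 9) (9 / 14) h10 x10 (by norm_num) (by norm_num)
    have x8 := h.le_X_of (n := n + 8) (14 / 23) h9 x9 (by norm_num)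
    linarith
  refine ⟨h9, h10, (h.fourRun_or (n := n + 8) h11).resolve_left fun h14 => ?_⟩
  have h12 := h.next_eq_one h11
  have h13 := h.next_next_eq_one h11
  have x13 := h.X_le_of (n := n + 13) (4 / 13) h14 (h.le_X _) (by norm_num) (by norm_num)
  have x12 := h.le_X_of (n := n + 12) (13 / 17) h13 x13 (by norm_num)
  have x11 := h.X_le_of (n := n + 11) (17 / 30) h12 x12 (by norm_num) (by norm_num)
  have x10 := h.le_X_of (n := n + 10) (30 / 107) h11 x11 (by norm_num)
  have x9 := h.X_le_of (n := n + 9) (107 / 137) h10 x10 (by norm_num) (by norm_num)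
  have x8 := h.le_X_of (n := n + 8) (137 / 244) h9 x9 (by norm_num)
  linarith

theorem eventually_periodic (h : Reduced a X Y) :
    ∃ m, (∀ k, a (m + k) = 1) ∨ (∀ k, a (m + k) = if k % 3 = 0 then 3 else 1) ∨
      (∀ k, a (m + k) = if k % 8 = 0 ∨ k % 8 = 5 then 3 else 1) := by
  by_cases hthree : ∃ n, a (n + 3) = 3
  swap
  · push Not at hthree
    refine ⟨3, Or.inl fun k => ?_⟩
    rw [add_comm]
    exact (h.digit _).resolve_right (hthree k)
  obtain ⟨m, hm⟩ := hthree
  by_cases hfour : ∃ n, FourRun a (n + 3)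
  · obtain ⟨n, hn⟩ := hfour
    refine ⟨n + 3, Or.inr (Or.inr fun k => ?_)⟩
    have hall : ∀ j, FourRun a (n + 8 * j + 3) := by
      intro j
      induction j with
      | zero => exact hn
      | succ j ih => exact (h.fourRun_add_eight ih).2.2
    have h9 := (h.fourRun_add_eight (hall (k / 8))).1
    have h10 := (h.fourRun_add_eight (hall (k / 8))).2.1
    obtain ⟨h3, h4, h5, h6, h7, h8⟩ := hall (k / 8)
    have hk := Nat.div_add_mod k 8
    have hlt := Nat.mod_lt k (by norm_num : 8 > 0)
    have e : n + 3 + k = n + 8 * (k / 8) + 3 + k % 8 := by omega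
    rw [e]
    interval_cases k % 8 <;> assumption
  · push Not at hfour
    refine ⟨m + 3, Or.inr (Or.inl fun k => ?_)⟩
    have hall : ∀ j, a (m + 3 * j + 3) = 3 := by
      intro j
      induction j with
      | zero => exact hm
      | succ j ih => exact (h.fourRun_or ih).resolve_right (hfour _)
    have h3 := hall (k / 3)
    have h4 := h.next_eq_one h3
    have h5 := h.next_next_eq_one h3
    have hk := Nat.div_add_mod k 3
    have hlt := Nat.mod_lt k (by norm_num : 3 > 0)
    have e : m + 3 + k = m + 3 * (k / 3) + 3 + k % 3 := by omega
    rw [e]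
    interval_cases k % 3 <;> assumption

end Reduced

end Combinatorics

section Classification

variable {α : ℝ}

theorem exists_admissible (hα : Irrational α) (h : 9591 / 10000 < kConst α) :
    ∃ N : ℕ, Admissible (fun n => cfDigit α (N + n + 2))
      (fun n => Int.fract (cfTail α (N + n + 2)))
      (fun n => (cfDen α (N + n) : ℝ) / cfDen α (N + n + 1)) := by
  obtain ⟨Q, hQ⟩ := le_mul_abs_of_lt_kConst h
  obtain ⟨N, hN⟩ := exists_nat_ge Q
  have hq : ∀ n, (1 : ℝ) ≤ cfDen α n := fun n => by exact_mod_cast (one_le_cfDen hα n).1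
  have hlarge : ∀ n, N ≤ n → Q ≤ cfDen α n := fun n hn => by
    have h1 : (n : ℝ) ≤ cfDen α n := by exact_mod_cast le_cfDen hα n
    have h2 : (N : ℝ) ≤ n := by exact_mod_cast hn
    linarith
  have hTY : ∀ n, 0 < cfTail α (n + 2) + (cfDen α n : ℝ) / cfDen α (n + 1) := fun n =>
    add_pos_of_pos_of_nonneg (by linarith [one_lt_cfTail hα (n + 1)])
      (div_nonneg (by linarith [hq n]) (by linarith [hq (n + 1)]))
  have hscale : ∀ n, |cfErr α (n + 1)| * cfDen α (n + 1) *
      (cfTail α (n + 2) + (cfDen α n : ℝ) / cfDen α (n + 1)) = 1 := fun n => by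
    have h1 := hq (n + 1)
    rw [← abs_cfErr_mul hα n]
    field_simp
  have hmid : ∀ n, N ≤ n → ∀ r : ℤ, 1 ≤ r → r < cfDigit α (n + 2) →
      9591 / 10000 * (cfDigit α (n + 2) + Int.fract (cfTail α (n + 2)) +
        (cfDen α n : ℝ) / cfDen α (n + 1)) ≤
      (r + (cfDen α n : ℝ) / cfDen α (n + 1)) *
        (cfDigit α (n + 2) - r + Int.fract (cfTail α (n + 2))) := by
    intro n hn r hr hra
    obtain ⟨h0, h1⟩ := one_le_cfDen hα n
    have hlarge' := hlarge n hn
    have hr' : (1 : ℝ) ≤ r := by exact_mod_cast hr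
    have hval := hQ _ _ (by nlinarith) (by push_cast; nlinarith [hq n, hq (n + 1)])
      (nonConvergent_intermediate hα n hr hra)
    have hra' : (r : ℝ) + 1 ≤ cfDigit α (n + 2) := by exact_mod_cast hra
    have hf := Int.fract_nonneg (cfTail α (n + 2))
    have hT := cfTail_eq α (n + 2)
    have he : |((r * cfDen α (n + 1) + cfDen α n : ℤ) : ℝ) * α -
        ((r * cfNum α (n + 1) + cfNum α n : ℤ) : ℝ)| =
        |cfErr α (n + 1)| * (cfTail α (n + 2) - r) := by
      rw [← abs_of_nonneg (by linarith : 0 ≤ cfTail α (n + 2) - r), ← abs_mul, ← abs_neg]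
      congr 1
      have hn' := cfTail_mul_cfErr hα n
      simp only [cfErr] at hn' ⊢
      push_cast
      linear_combination -hn'
    rw [he] at hval
    push_cast at hval
    have hD := hscale n
    have hy := mul_le_mul_of_nonneg_right hval (hTY n).le
    have e1 : (cfDen α n : ℝ) = cfDen α n / cfDen α (n + 1) * cfDen α (n + 1) :=
      (div_mul_cancel₀ _ (by linarith [hq (n + 1)])).symm
    generalize (cfDen α n : ℝ) / cfDen α (n + 1) = y at *
    rw [e1] at hy
    rw [← hT]
    refine hy.trans_eq ?_
    linear_combination (r + y) * (cfTail α (n + 2) - r) * hD + (r + y) * hT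
  have hdouble : ∀ n, N ≤ n → 9591 / 10000 * (cfDigit α (n + 2) +
      Int.fract (cfTail α (n + 2)) + (cfDen α n : ℝ) / cfDen α (n + 1)) ≤ 4 := by
    intro n hn
    have hval := hQ _ _ (by linarith [(one_le_cfDen hα n).2])
      (by push_cast; linarith [hlarge (n + 1) (by omega), hq (n + 1)])
      (nonConvergent_two_mul α (n + 1))
    have he : |((2 * cfDen α (n + 1) : ℤ) : ℝ) * α - ((2 * cfNum α (n + 1) : ℤ) : ℝ)| =
        2 * |cfErr α (n + 1)| := by
      rw [← abs_of_pos (two_pos : (0 : ℝ) < 2), ← abs_mul, cfErr]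
      push_cast
      ring_nf
    rw [he] at hval
    push_cast at hval
    rw [← cfTail_eq α (n + 2)]
    refine (mul_le_mul_of_nonneg_right hval (hTY n).le).trans_eq ?_
    linear_combination 4 * hscale n
  refine ⟨N, ?_, ?_, ?_, ?_, ?_, ?_, ?_, ?_, ?_, ?_⟩ <;> intro n
  · exact one_le_cfDigit hα _
  · exact fract_cfTail_pos hα _
  · exact Int.fract_lt_one _
  · exact div_pos (by linarith [hq (N + n)]) (by linarith [hq (N + n + 1)])
  · exact div_le_one_of_le₀ (by exact_mod_cast monotone_cfDen hα (Nat.le_succ (N + n)))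
      (by linarith [hq (N + n + 1)])
  · rw [← Nat.add_assoc, Nat.add_right_comm (N + n) 1 2, fract_cfTail, ← cfTail_eq]
    exact inv_mul_cancel₀ (by linarith [one_lt_cfTail hα (N + n + 2)])
  · have h0 := hq (N + n)
    have h1 := hq (N + n + 1)
    have h2 := hq (N + n + 2)
    have h3 : (cfDen α (N + n + 2) : ℝ) =
        cfDigit α (N + n + 2) * cfDen α (N + n + 1) + cfDen α (N + n) := by
      rw [cfDen]; push_cast; ring
    rw [← Nat.add_assoc, div_mul_eq_mul_div, div_eq_one_iff_eq (by linarith), h3, mul_add,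
      mul_div_cancel₀ _ (by linarith)]
    ring
  · exact hdouble (N + n) (Nat.le_add_right N n)
  · intro ha
    have := hmid (N + n) (Nat.le_add_right N n) 1 le_rfl (by linarith)
    push_cast at this
    exact this
  · intro ha
    have := hmid (N + n) (Nat.le_add_right N n) (cfDigit α (N + n + 2) - 1) (by linarith)
      (by linarith)
    push_cast at this
    linarith

/-- The three possible tails of the partial quotients when `𝔨(α) > 0.9591`. -/
def tailPattern (i : Fin 3) (k : ℕ) : ℤ :=
  ![1, if k % 3 = 0 then 3 else 1, if k % 8 = 0 ∨ k % 8 = 5 then 3 else 1] i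

theorem exists_tailPattern (hα : Irrational α) (h : 9591 / 10000 < kConst α) :
    ∃ i m, ∀ k, cfDigit α (m + k) = tailPattern i k := by
  obtain ⟨N, hN⟩ := exists_admissible hα h
  obtain ⟨m, hm⟩ := hN.reduced.eventually_periodic
  have e : ∀ k, N + 2 + m + 2 + k = N + (m + k + 2) + 2 := fun k => by omega
  rcases hm with hm | hm | hm
  · exact ⟨0, N + 2 + m + 2, fun k => by rw [e]; exact hm k⟩
  · exact ⟨1, N + 2 + m + 2, fun k => by rw [e]; exact hm k⟩
  · exact ⟨2, N + 2 + m + 2, fun k => by rw [e]; exact hm k⟩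

theorem finite_L2_inter_Ioi : (L2 ∩ Set.Ioi (9591 / 10000)).Finite := by
  have hsub : L2 ∩ Set.Ioi (9591 / 10000) ⊆ ⋃ i : Fin 3,
      {x | ∃ α, Irrational α ∧ x = kConst α ∧ ∃ m, ∀ k, cfDigit α (m + k) = tailPattern i k} := by
    rintro x ⟨⟨α, hα, rfl⟩, hx⟩
    obtain ⟨i, m, hm⟩ := exists_tailPattern hα hx
    exact Set.mem_iUnion.2 ⟨i, α, hα, rfl, m, hm⟩
  refine (Set.finite_iUnion fun i => Set.Subsingleton.finite ?_).subset hsub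
  rintro _ ⟨α, hα, rfl, m, hm⟩ _ ⟨β, hβ, rfl, n, hn⟩
  exact kConst_eq_of_cfDigit_eq hα hβ fun k => (hm k).trans (hn k).symm

end Classification

/-- The point `164/(13√173)` is an isolated point of the spectrum `𝕃₂`. -/
theorem stmt_7 :
    ∃ ε : ℝ, 0 < ε ∧ ∀ x ∈ L2,
      x ∈ Set.Ioo (164 / (13 * Real.sqrt 173) - ε) (164 / (13 * Real.sqrt 173) + ε) →
      x = 164 / (13 * Real.sqrt 173) := by
  set c : ℝ := 164 / (13 * Real.sqrt 173) with hc
  have hlow : 9591 / 10000 < c := by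
    have h1 : Real.sqrt 173 < 131530 / 10000 := by
      rw [Real.sqrt_lt' (by norm_num)]
      norm_num
    have h0 : 0 < Real.sqrt 173 := by positivity
    rw [hc, lt_div_iff₀ (by positivity)]
    linarith
  have hopen : IsOpen (((L2 ∩ Set.Ioi (9591 / 10000)) \ {c})ᶜ ∩ Set.Ioi (9591 / 10000)) :=
    (finite_L2_inter_Ioi.sdiff.isClosed.isOpen_compl).inter isOpen_Ioi
  obtain ⟨ε, hε, hball⟩ := Metric.isOpen_iff.1 hopen c ⟨fun h => h.2 rfl, hlow⟩
  refine ⟨ε, hε, fun x hx hxc => ?_⟩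
  rw [← Real.ball_eq_Ioo] at hxc
  obtain ⟨h1, h2⟩ := hball hxc
  by_contra hne
  exact h1 ⟨⟨hx, h2⟩, hne⟩
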